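/- Fix nonempty finite sets Ω and A, a finite message set M with |M| > max{|Ω|, |A|}, and an interior prior μ₀ on Ω. If an environment (u_S, u_R) is jointly-inclusive, satisfies partitional-unique-response and scant-indifferences, and commitment has no value, then the environment is felicitous. -/

import Mathlib

open MeasureTheory

namespace KL

/-- `f` is a probability distribution on the finite type `X`. -/
def IsDist {X : Type} [Fintype X] (f : X → ℝ) : Prop :=
  (∀ x, 0 ≤ f x) ∧ ∑ x, f x = 1

/-- `μ₀` is an interior prior on `Ω`. -/
def IsPrior {Ω : Type} [Fintype Ω] (μ₀ : Ω → ℝ) : Prop :=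
  (∀ ω, 0 < μ₀ ω) ∧ ∑ ω, μ₀ ω = 1

variable {Ω A M : Type} [Fintype Ω] [Fintype A] [Fintype M]

/-- A messaging strategy: a distribution over messages in each state. -/
def IsMsg (σ : Ω → M → ℝ) : Prop := ∀ ω, IsDist (σ ω)

/-- An action strategy: a distribution over actions after each message. -/
def IsAct (ρ : M → A → ℝ) : Prop := ∀ m, IsDist (ρ m)

/-- Expected payoff of a profile `(σ, ρ)` for utility `u`. -/
def U (μ₀ : Ω → ℝ) (u : A × Ω → ℝ) (σ : Ω → M → ℝ) (ρ : M → A → ℝ) : ℝ :=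
  ∑ ω, ∑ m, ∑ a, μ₀ ω * σ ω m * ρ m a * u (a, ω)

/-- Sender best response. -/
def SBR (μ₀ : Ω → ℝ) (uS : A × Ω → ℝ) (σ : Ω → M → ℝ) (ρ : M → A → ℝ) : Prop :=
  ∀ σ' : Ω → M → ℝ, IsMsg σ' → U μ₀ uS σ' ρ ≤ U μ₀ uS σ ρ

/-- Receiver best response. -/
def RBR (μ₀ : Ω → ℝ) (uR : A × Ω → ℝ) (σ : Ω → M → ℝ) (ρ : M → A → ℝ) : Prop :=
  ∀ ρ' : M → A → ℝ, IsAct ρ' → U μ₀ uR σ ρ' ≤ U μ₀ uR σ ρ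

/-- A cheap-talk equilibrium: a profile of valid strategies that is S-BR and R-BR. -/
def CTEq (μ₀ : Ω → ℝ) (uS uR : A × Ω → ℝ) (σ : Ω → M → ℝ) (ρ : M → A → ℝ) : Prop :=
  IsMsg σ ∧ IsAct ρ ∧ SBR μ₀ uS σ ρ ∧ RBR μ₀ uR σ ρ

/-- A persuasion profile: a profile of valid strategies that is R-BR. -/
def PersProfile (μ₀ : Ω → ℝ) (uR : A × Ω → ℝ) (σ : Ω → M → ℝ) (ρ : M → A → ℝ) : Prop :=
  IsMsg σ ∧ IsAct ρ ∧ RBR μ₀ uR σ ρ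

/-- The cheap-talk payoff: the maximal Sender payoff over cheap-talk equilibria. -/
noncomputable def ctPayoff (μ₀ : Ω → ℝ) (uS uR : A × Ω → ℝ) : ℝ :=
  sSup {x | ∃ (σ : Ω → M → ℝ) (ρ : M → A → ℝ), CTEq μ₀ uS uR σ ρ ∧ x = U μ₀ uS σ ρ}

/-- The (Bayesian) persuasion payoff: the maximal Sender payoff over persuasion profiles. -/
noncomputable def persPayoff (μ₀ : Ω → ℝ) (uS uR : A × Ω → ℝ) : ℝ :=
  sSup {x | ∃ (σ : Ω → M → ℝ) (ρ : M → A → ℝ), PersProfile μ₀ uR σ ρ ∧ x = U μ₀ uS σ ρ}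

/-- A messaging strategy is partitional if it is deterministic in every state. -/
def Partitional (σ : Ω → M → ℝ) : Prop := ∀ ω, ∃ m, σ ω m = 1

/-- The partitional persuasion payoff. -/
noncomputable def partPersPayoff (μ₀ : Ω → ℝ) (uS uR : A × Ω → ℝ) : ℝ :=
  sSup {x | ∃ (σ : Ω → M → ℝ) (ρ : M → A → ℝ),
    Partitional σ ∧ PersProfile μ₀ uR σ ρ ∧ x = U μ₀ uS σ ρ}

/-- The partitional cheap-talk payoff. -/
noncomputable def partCtPayoff (μ₀ : Ω → ℝ) (uS uR : A × Ω → ℝ) : ℝ :=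
  sSup {x | ∃ (σ : Ω → M → ℝ) (ρ : M → A → ℝ),
    Partitional σ ∧ CTEq μ₀ uS uR σ ρ ∧ x = U μ₀ uS σ ρ}

/-- A message is on-path if it is sent with positive probability in some state. -/
def OnPath (σ : Ω → M → ℝ) (m : M) : Prop := ∃ ω, 0 < σ ω m

/-- A pure action strategy: degenerate after every message. -/
def IsPureAct (ρ : M → A → ℝ) : Prop := ∀ m, ∃ a, ρ m a = 1

/-- A pure-on-path action strategy: degenerate after every on-path message. -/
def PureOnPath (σ : Ω → M → ℝ) (ρ : M → A → ℝ) : Prop :=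
  ∀ m, OnPath σ m → ∃ a, ρ m a = 1

/-- The posterior belief induced by message `m`. -/
noncomputable def post (μ₀ : Ω → ℝ) (σ : Ω → M → ℝ) (m : M) (ω : Ω) : ℝ :=
  μ₀ ω * σ ω m / ∑ ω', μ₀ ω' * σ ω' m

/-- The cube of environments `[0,1]^(2|A||Ω|)`. -/
def EnvCube (Ω A : Type) : Set ((A × Ω → ℝ) × (A × Ω → ℝ)) :=
  {e | (∀ p, e.1 p ∈ Set.Icc (0 : ℝ) 1) ∧ ∀ p, e.2 p ∈ Set.Icc (0 : ℝ) 1}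

/-- The cube of transparent environments `[0,1]^(|A|(|Ω|+1))`, points `(v, u_R)`. -/
def TransCube (Ω A : Type) : Set ((A → ℝ) × (A × Ω → ℝ)) :=
  {e | (∀ a, e.1 a ∈ Set.Icc (0 : ℝ) 1) ∧ ∀ p, e.2 p ∈ Set.Icc (0 : ℝ) 1}

open Classical in
/-- The expanded-indifference matrix `T^i`: rows `u_S(a_j,·) − u_S(a_i,·)` for `j ≠ i`,
rows `u_R(a_j,·) − u_R(a_i,·)` for `j ≠ i`, and the rows of the identity matrix. -/
noncomputable def TMat (uS uR : A × Ω → ℝ) (i : A) :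
    Matrix (({j : A // j ≠ i} ⊕ {j : A // j ≠ i}) ⊕ Ω) Ω ℝ :=
  Matrix.of fun r ω =>
    match r with
    | Sum.inl (Sum.inl j) => uS (j.1, ω) - uS (i, ω)
    | Sum.inl (Sum.inr j) => uR (j.1, ω) - uR (i, ω)
    | Sum.inr ω' => if ω' = ω then 1 else 0

/-- Scant indifferences: every row-submatrix of every expanded-indifference matrix has
full rank (rank equal to the minimum of the number of rows and the number of columns). -/
def ScantIndiff (uS uR : A × Ω → ℝ) : Prop :=
  ∀ i : A, ∀ s : Finset (({j : A // j ≠ i} ⊕ {j : A // j ≠ i}) ⊕ Ω),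
    ((TMat uS uR i).submatrix (fun r : {x // x ∈ s} => r.1) id).rank
      = min s.card (Fintype.card Ω)

open Classical in
/-- The set `Ω_a` of states in which `a` is an ideal action for Sender. -/
noncomputable def idealStates (uS : A × Ω → ℝ) (a : A) : Finset Ω :=
  Finset.univ.filter fun ω => ∀ b, uS (b, ω) ≤ uS (a, ω)

/-- Felicitous environment. -/
def Felicitous (μ₀ : Ω → ℝ) (uS uR : A × Ω → ℝ) : Prop :=
  ∀ a a' : A, 0 ≤ ∑ ω ∈ idealStates uS a, μ₀ ω * (uR (a, ω) - uR (a', ω))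

/-- Partitional-unique-response: for every nonempty subset of states, Receiver's
expected payoff has a unique maximizer. -/
def PUR (μ₀ : Ω → ℝ) (uR : A × Ω → ℝ) : Prop :=
  ∀ S : Finset Ω, S.Nonempty →
    ∃! a : A, ∀ b : A, ∑ ω ∈ S, μ₀ ω * uR (b, ω) ≤ ∑ ω ∈ S, μ₀ ω * uR (a, ω)

/-- Jointly-inclusive environment: each action is the unique ideal action of both
players in some state. -/
def JointlyInclusive (uS uR : A × Ω → ℝ) : Prop :=
  ∀ a : A, ∃ ω : Ω,
    (∀ b, b ≠ a → uS (b, ω) < uS (a, ω)) ∧ ∀ b, b ≠ a → uR (b, ω) < uR (a, ω)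

/-- Obedient recommendation measures. -/
structure Feas (μ₀ : Ω → ℝ) (uR : A × Ω → ℝ) (y : A → Ω → ℝ) : Prop where
  nonneg : ∀ a ω, 0 ≤ y a ω
  total : ∀ ω, ∑ a, y a ω = μ₀ ω
  obed : ∀ a b, ∑ ω, y a ω * uR (b, ω) ≤ ∑ ω, y a ω * uR (a, ω)

lemma U_le_one (μ₀ : Ω → ℝ) (hμ : IsPrior μ₀) (u : A × Ω → ℝ)
    (hu : ∀ p, u p ∈ Set.Icc (0 : ℝ) 1) (σ : Ω → M → ℝ) (ρ : M → A → ℝ)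
    (hσ : IsMsg σ) (hρ : IsAct ρ) : U μ₀ u σ ρ ≤ 1 := by
  unfold U
  calc ∑ ω, ∑ m, ∑ a, μ₀ ω * σ ω m * ρ m a * u (a, ω)
      ≤ ∑ ω, ∑ m, ∑ a, μ₀ ω * σ ω m * ρ m a := by
        refine Finset.sum_le_sum fun ω _ => Finset.sum_le_sum fun m _ =>
          Finset.sum_le_sum fun a _ => ?_
        have h : 0 ≤ μ₀ ω * σ ω m * ρ m a :=
          mul_nonneg (mul_nonneg (hμ.1 ω).le ((hσ ω).1 m)) ((hρ m).1 a)
        exact mul_le_of_le_one_right h (hu _).2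
    _ = 1 := by
        simp_rw [← Finset.mul_sum, (hρ _).2, mul_one, ← Finset.mul_sum, (hσ _).2, mul_one, hμ.2]

lemma U_eq_act (μ₀ : Ω → ℝ) (u : A × Ω → ℝ) (σ : Ω → M → ℝ) (ρ : M → A → ℝ) :
    U μ₀ u σ ρ = ∑ m, ∑ a, ρ m a * ∑ ω, μ₀ ω * σ ω m * u (a, ω) := by
  unfold U
  rw [Finset.sum_comm]
  refine Finset.sum_congr rfl fun m _ => ?_
  rw [Finset.sum_comm]
  refine Finset.sum_congr rfl fun a _ => ?_
  rw [Finset.mul_sum]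
  exact Finset.sum_congr rfl fun ω _ => by ring

lemma U_eq_msg (μ₀ : Ω → ℝ) (u : A × Ω → ℝ) (σ : Ω → M → ℝ) (ρ : M → A → ℝ) :
    U μ₀ u σ ρ = ∑ ω, ∑ m, σ ω m * (μ₀ ω * ∑ a, ρ m a * u (a, ω)) := by
  unfold U
  refine Finset.sum_congr rfl fun ω _ => Finset.sum_congr rfl fun m _ => ?_
  rw [Finset.mul_sum, Finset.mul_sum]
  exact Finset.sum_congr rfl fun a _ => by ring

lemma pointwise_opt {I K : Type} [Fintype I] [Fintype K] (p V : I → K → ℝ)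
    (hp : ∀ i, IsDist (p i))
    (h : ∀ p' : I → K → ℝ, (∀ i, IsDist (p' i)) →
      ∑ i, ∑ k, p' i k * V i k ≤ ∑ i, ∑ k, p i k * V i k)
    (i : I) (k k' : K) (hk : 0 < p i k) : V i k' ≤ V i k := by
  classical
  have key := h (fun i' l => p i' l + (if i' = i then
      p i k * ((if l = k' then 1 else 0) - (if l = k then 1 else 0)) else 0)) ?_
  · simp only [add_mul, Finset.sum_add_distrib, ite_mul, zero_mul] at key
    have e : ∑ x, ∑ x_1, (if x = i then
        p i k * ((if x_1 = k' then 1 else 0) - (if x_1 = k then 1 else 0)) * V x x_1 else 0)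
        = p i k * (V i k' - V i k) := by
      rw [Finset.sum_eq_single i]
      · simp [mul_assoc, ← Finset.mul_sum, sub_mul, Finset.sum_sub_distrib]
      · intro b _ hb; simp [hb]
      · simp
    rw [e] at key
    by_contra hc
    push Not at hc
    have := mul_pos hk (sub_pos.2 hc)
    linarith
  · intro i'
    refine ⟨fun l => ?_, ?_⟩
    · by_cases hi : i' = i
      · subst hi
        by_cases h1 : l = k'
        · by_cases h2 : l = k
          · have := (hp i').1 l
            simp only [if_true, if_pos h1, if_pos h2, sub_self, mul_zero, add_zero]; exact this
          · have := (hp i').1 l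
            simp only [if_true, if_pos h1, if_neg h2]; linarith
        · by_cases h2 : l = k
          · subst h2; simp [h1]
          · simp [h1, h2]; exact (hp i').1 _
      · simp [hi]; exact (hp i').1 _
    · rw [Finset.sum_add_distrib, (hp i').2]
      by_cases hi : i' = i
      · simp [hi, ← Finset.mul_sum, Finset.sum_sub_distrib]
      · simp [hi]

lemma feas_le (hM : Fintype.card A ≤ Fintype.card M) [Nonempty A]
    (μ₀ : Ω → ℝ) (hμ : IsPrior μ₀) (uS uR : A × Ω → ℝ)
    (huS : ∀ p, uS p ∈ Set.Icc (0 : ℝ) 1) (y : A → Ω → ℝ) (hy : Feas μ₀ uR y) :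
    ∑ a, ∑ ω, y a ω * uS (a, ω) ≤ persPayoff (M := M) μ₀ uS uR := by
  classical
  obtain ⟨e⟩ := Function.Embedding.nonempty_of_card_le hM
  let f : M → A := Function.invFun e
  have hf : ∀ a, f (e a) = a := Function.leftInverse_invFun e.injective
  let σ : Ω → M → ℝ := fun ω m => ∑ a, if m = e a then y a ω / μ₀ ω else 0
  let ρ : M → A → ℝ := fun m a => if a = f m then 1 else 0
  have hσ : IsMsg σ := by
    intro ω
    refine ⟨fun m => Finset.sum_nonneg fun a _ => ?_, ?_⟩
    · split_ifs
      · exact div_nonneg (hy.nonneg _ _) (hμ.1 ω).le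
      · exact le_rfl
    · show ∑ m, ∑ a, (if m = e a then y a ω / μ₀ ω else 0) = 1
      rw [Finset.sum_comm]
      simp [← Finset.sum_div, hy.total, (hμ.1 ω).ne']
  have hρ : IsAct ρ := fun m => ⟨fun a => by simp only [ρ]; split_ifs <;> norm_num, by simp [ρ]⟩
  have hU : ∀ (u : A × Ω → ℝ) (ρ' : M → A → ℝ),
      U μ₀ u σ ρ' = ∑ a, ∑ b, ρ' (e a) b * ∑ ω, y a ω * u (b, ω) := by
    intro u ρ'
    have h1 : ∀ ω m b, μ₀ ω * σ ω m * u (b, ω)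
        = ∑ a, if m = e a then y a ω * u (b, ω) else 0 := by
      intro ω m b
      simp only [σ, Finset.mul_sum, Finset.sum_mul]
      refine Finset.sum_congr rfl fun a _ => ?_
      have := (hμ.1 ω).ne'
      split_ifs
      · field_simp
      · simp
    rw [U_eq_act]
    have h2 : ∀ m b, ρ' m b * ∑ ω, μ₀ ω * σ ω m * u (b, ω)
        = ∑ a, if m = e a then ρ' (e a) b * ∑ ω, y a ω * u (b, ω) else 0 := by
      intro m b
      simp_rw [h1]
      rw [Finset.sum_comm, Finset.mul_sum]
      refine Finset.sum_congr rfl fun a _ => ?_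
      split_ifs with h
      · rw [h]
      · simp
    simp_rw [h2]
    rw [Finset.sum_comm]
    have h3 : ∀ b : A, ∑ m, ∑ a, (if m = e a then ρ' (e a) b * ∑ ω, y a ω * u (b, ω) else 0)
        = ∑ a, ρ' (e a) b * ∑ ω, y a ω * u (b, ω) := by
      intro b
      rw [Finset.sum_comm]
      simp
    simp_rw [h3]
    rw [Finset.sum_comm]
  have hUρ : ∀ u : A × Ω → ℝ, U μ₀ u σ ρ = ∑ a, ∑ ω, y a ω * u (a, ω) := by
    intro u
    rw [hU]
    simp [ρ, hf]
  refine le_csSup ⟨1, ?_⟩ ⟨σ, ρ, ⟨hσ, hρ, ?_⟩, (hUρ uS).symm⟩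
  · rintro _ ⟨σ', ρ', h, rfl⟩
    exact U_le_one μ₀ hμ uS huS σ' ρ' h.1 h.2.1
  · intro ρ' hρ'
    rw [hUρ, hU]
    refine Finset.sum_le_sum fun a _ => ?_
    calc ∑ b, ρ' (e a) b * ∑ ω, y a ω * uR (b, ω)
        ≤ ∑ b, ρ' (e a) b * ∑ ω, y a ω * uR (a, ω) :=
          Finset.sum_le_sum fun b _ => mul_le_mul_of_nonneg_left (hy.obed a b) ((hρ' _).1 b)
      _ = _ := by rw [← Finset.sum_mul, (hρ' _).2, one_mul]

lemma ev_nonneg (c e : ℝ) (hc : 0 ≤ c) (h : 0 < c ∨ 0 ≤ e) :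
    ∀ᶠ ε in nhdsWithin (0 : ℝ) (Set.Ioi 0), 0 ≤ c + ε * e := by
  rcases h with h | h
  · have : Filter.Tendsto (fun ε : ℝ => c + ε * e) (nhdsWithin 0 (Set.Ioi 0)) (nhds (c + 0 * e)) :=
      ((by fun_prop : Continuous fun ε : ℝ => c + ε * e).tendsto 0).mono_left nhdsWithin_le_nhds
    rw [zero_mul, add_zero] at this
    filter_upwards [this.eventually (lt_mem_nhds h)] with ε hε using hε.le
  · filter_upwards [self_mem_nhdsWithin] with ε hε
    exact add_nonneg hc (mul_nonneg (le_of_lt hε) h)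

lemma perturb (hM : Fintype.card A ≤ Fintype.card M) [Nonempty A]
    (μ₀ : Ω → ℝ) (hμ : IsPrior μ₀) (uS uR : A × Ω → ℝ)
    (huS : ∀ p, uS p ∈ Set.Icc (0 : ℝ) 1) (y : A → Ω → ℝ) (hy : Feas μ₀ uR y)
    (hopt : persPayoff (M := M) μ₀ uS uR ≤ ∑ a, ∑ ω, y a ω * uS (a, ω))
    (i j : A) (hij : i ≠ j) (d : Ω → ℝ)
    (h1 : ∀ ω, 0 < y i ω ∨ 0 ≤ - d ω) (h2 : ∀ ω, 0 < y j ω ∨ 0 ≤ d ω)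
    (h3 : ∀ b, ∑ ω, y i ω * uR (b, ω) < ∑ ω, y i ω * uR (i, ω) ∨
      0 ≤ ∑ ω, d ω * (uR (b, ω) - uR (i, ω)))
    (h4 : ∀ b, ∑ ω, y j ω * uR (b, ω) < ∑ ω, y j ω * uR (j, ω) ∨
      0 ≤ ∑ ω, d ω * (uR (j, ω) - uR (b, ω))) :
    ∑ ω, d ω * (uS (j, ω) - uS (i, ω)) ≤ 0 := by
  classical
  have e1 := Filter.eventually_all.2 fun ω => ev_nonneg _ _ (hy.nonneg i ω) (h1 ω)
  have e2 := Filter.eventually_all.2 fun ω => ev_nonneg _ _ (hy.nonneg j ω) (h2 ω)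
  have e3 := Filter.eventually_all.2 fun b => ev_nonneg _ _ (sub_nonneg.2 (hy.obed i b))
    ((h3 b).imp_left sub_pos.2)
  have e4 := Filter.eventually_all.2 fun b => ev_nonneg _ _ (sub_nonneg.2 (hy.obed j b))
    ((h4 b).imp_left sub_pos.2)
  obtain ⟨ε, hε, f1, f2, f3, f4⟩ :=
    ((Filter.Eventually.and (self_mem_nhdsWithin : ∀ᶠ ε in nhdsWithin (0 : ℝ) (Set.Ioi 0),
      ε ∈ Set.Ioi (0 : ℝ)) (e1.and (e2.and (e3.and e4)))).exists)
  have hε : 0 < ε := hε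
  let y' : A → Ω → ℝ := fun a ω =>
    y a ω + ((if a = j then ε * d ω else 0) - (if a = i then ε * d ω else 0))
  have yi : ∀ ω, y' i ω = y i ω + ε * (- d ω) := by intro ω; simp [y', hij]
  have yj : ∀ ω, y' j ω = y j ω + ε * d ω := by intro ω; simp [y', hij.symm]
  have yo : ∀ a, a ≠ i → a ≠ j → y' a = y a := by intro a h h'; ext ω; simp [y', h, h']
  have hf : Feas μ₀ uR y' := by
    refine ⟨fun a ω => ?_, fun ω => ?_, fun a b => ?_⟩
    · by_cases hi : a = i
      · subst hi; rw [yi]; exact f1 ω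
      by_cases hj : a = j
      · subst hj; rw [yj]; exact f2 ω
      rw [yo a hi hj]; exact hy.nonneg a ω
    · simp [y', Finset.sum_add_distrib, Finset.sum_sub_distrib, hy.total]
    · by_cases hi : a = i
      · subst hi
        have := f3 b
        simp_rw [yi]
        rw [← sub_nonneg]
        convert this using 1
        simp only [Finset.mul_sum, ← Finset.sum_sub_distrib, ← Finset.sum_add_distrib]
        exact Finset.sum_congr rfl fun ω _ => by ring
      by_cases hj : a = j
      · subst hj
        have := f4 b
        simp_rw [yj]
        rw [← sub_nonneg]
        convert this using 1
        simp only [Finset.mul_sum, ← Finset.sum_sub_distrib, ← Finset.sum_add_distrib]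
        exact Finset.sum_congr rfl fun ω _ => by ring
      rw [yo a hi hj]; exact hy.obed a b
  have hle := (feas_le hM μ₀ hμ uS uR huS y' hf).trans hopt
  have heq : ∑ a, ∑ ω, y' a ω * uS (a, ω) = ∑ a, ∑ ω, y a ω * uS (a, ω)
      + ε * ∑ ω, d ω * (uS (j, ω) - uS (i, ω)) := by
    rw [Finset.sum_comm, Finset.sum_comm (f := fun a ω => y a ω * uS (a, ω)), Finset.mul_sum,
      ← Finset.sum_add_distrib]
    refine Finset.sum_congr rfl fun ω _ => ?_
    simp only [y', add_mul, sub_mul, ite_mul, zero_mul, Finset.sum_add_distrib,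
      Finset.sum_sub_distrib, Finset.sum_ite_eq', Finset.mem_univ, if_true]
    ring
  rw [heq] at hle
  by_contra hc
  push Not at hc
  have := mul_pos hε hc
  linarith

lemma scant_dir (uS uR : A × Ω → ℝ) (hs : ScantIndiff uS uR) (i j : A) (hij : j ≠ i)
    (B : A → Prop) (x : Ω → ℝ) (hx : x ≠ 0)
    (hB : ∀ b, B b → ∑ ω, x ω * (uR (b, ω) - uR (i, ω)) = 0) :
    ∃ d : Ω → ℝ, (∀ ω, x ω = 0 → d ω = 0) ∧
      (∀ b, B b → ∑ ω, d ω * (uR (b, ω) - uR (i, ω)) = 0) ∧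
      ∑ ω, d ω * (uS (j, ω) - uS (i, ω)) ≠ 0 := by
  classical
  by_contra hc
  push Not at hc
  let Q : (({j : A // j ≠ i} ⊕ {j : A // j ≠ i}) ⊕ Ω) → Prop := fun r =>
    match r with
    | Sum.inl (Sum.inl _) => False
    | Sum.inl (Sum.inr b) => B b.1
    | Sum.inr ω => x ω = 0
  let s : Finset (({j : A // j ≠ i} ⊕ {j : A // j ≠ i}) ⊕ Ω) := Finset.univ.filter Q
  let r0 : (({j : A // j ≠ i} ⊕ {j : A // j ≠ i}) ⊕ Ω) := Sum.inl (Sum.inl ⟨j, hij⟩)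
  have hr0 : r0 ∉ s := by simp [s, r0, Q]
  have hker : ∀ (t : Finset (({j : A // j ≠ i} ⊕ {j : A // j ≠ i}) ⊕ Ω)) (d : Ω → ℝ),
      d ∈ LinearMap.ker ((TMat uS uR i).submatrix (fun r : {x // x ∈ t} => r.1) id).mulVecLin
      ↔ ∀ r ∈ t, ∑ ω, d ω * TMat uS uR i r ω = 0 := by
    intro t d
    rw [LinearMap.mem_ker, Matrix.mulVecLin_apply, funext_iff]
    simp only [Matrix.mulVec, dotProduct, Matrix.submatrix_apply, id, Pi.zero_apply, Subtype.forall]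
    simp only [mul_comm]
  have hkQ : ∀ d : Ω → ℝ, (∀ r ∈ s, ∑ ω, d ω * TMat uS uR i r ω = 0) ↔
      ((∀ ω, x ω = 0 → d ω = 0) ∧
      (∀ b, B b → ∑ ω, d ω * (uR (b, ω) - uR (i, ω)) = 0)) := by
    intro d
    constructor
    · intro h
      refine ⟨fun ω hω => ?_, fun b hb => ?_⟩
      · have := h (Sum.inr ω) (by simp [s, Q, hω])
        simpa [TMat] using this
      · by_cases hbi : b = i
        · simp [hbi]
        · have := h (Sum.inl (Sum.inr ⟨b, hbi⟩)) (by simp [s, Q, hb])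
          simpa [TMat] using this
    · rintro ⟨h1, h2⟩ r hr
      rcases r with (b | b) | ω
      · simp [s, Q] at hr
      · simp only [s, Q, Finset.mem_filter, Finset.mem_univ, true_and] at hr
        simpa [TMat] using h2 b.1 hr
      · simp only [s, Q, Finset.mem_filter, Finset.mem_univ, true_and] at hr
        simpa [TMat] using h1 ω hr
  have hxs := (hkQ x).2 ⟨fun _ h => h, hB⟩
  have hkeq : LinearMap.ker ((TMat uS uR i).submatrix
        (fun r : {x // x ∈ insert r0 s} => r.1) id).mulVecLin
      = LinearMap.ker ((TMat uS uR i).submatrix (fun r : {x // x ∈ s} => r.1) id).mulVecLin := by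
    ext d
    rw [hker, hker]
    constructor
    · intro h r hr; exact h r (Finset.mem_insert_of_mem hr)
    · intro h r hr
      rcases Finset.mem_insert.1 hr with rfl | hr
      · have := (hkQ d).1 h
        simpa [TMat, r0] using hc d this.1 this.2
      · exact h r hr
  have n1 := LinearMap.finrank_range_add_finrank_ker
    ((TMat uS uR i).submatrix (fun r : {x // x ∈ insert r0 s} => r.1) id).mulVecLin
  have n2 := LinearMap.finrank_range_add_finrank_ker
    ((TMat uS uR i).submatrix (fun r : {x // x ∈ s} => r.1) id).mulVecLin
  have s1 := hs i (insert r0 s)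
  have s2 := hs i s
  rw [Matrix.rank] at s1 s2
  rw [hkeq, s1] at n1
  rw [s2] at n2
  rw [Finset.card_insert_of_notMem hr0] at n1
  have hpos : 0 < Module.finrank ℝ (LinearMap.ker
      ((TMat uS uR i).submatrix (fun r : {x // x ∈ s} => r.1) id).mulVecLin) := by
    have : Nontrivial (LinearMap.ker
      ((TMat uS uR i).submatrix (fun r : {x // x ∈ s} => r.1) id).mulVecLin) :=
      ⟨⟨⟨x, (hker s x).2 hxs⟩, 0, fun h => hx (congrArg Subtype.val h)⟩⟩
    exact Module.finrank_pos
  rw [Module.finrank_fintype_fun_eq_card] at n1 n2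
  omega

lemma scant_strict (uS uR : A × Ω → ℝ) (hs : ScantIndiff uS uR) (a b : A) (ω : Ω)
    (h : uS (a, ω) = uS (b, ω)) : a = b := by
  classical
  by_contra hab
  obtain ⟨d, h1, -, h3⟩ := scant_dir uS uR hs a b (Ne.symm hab) (fun _ => False)
    (Pi.single ω 1) (by simp) (by simp)
  apply h3
  refine Finset.sum_eq_zero fun ω' _ => ?_
  by_cases hω : ω' = ω
  · subst hω; simp [h]
  · rw [h1 ω' (by simp [hω]), zero_mul]

lemma U_cont (μ₀ : Ω → ℝ) (u : A × Ω → ℝ) :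
    Continuous fun p : (Ω → M → ℝ) × (M → A → ℝ) => U μ₀ u p.1 p.2 := by
  unfold U
  fun_prop

lemma isClosed_dist {X : Type} [Fintype X] : IsClosed {f : X → ℝ | IsDist f} := by
  have : {f : X → ℝ | IsDist f} = (⋂ x, {f : X → ℝ | 0 ≤ f x}) ∩ {f | ∑ x, f x = 1} := by
    ext f; simp [IsDist]
  rw [this]
  exact (isClosed_iInter fun x => isClosed_le continuous_const (continuous_apply x)).inter
    (isClosed_eq (by fun_prop) continuous_const)

lemma isClosed_SBR (μ₀ : Ω → ℝ) (uS : A × Ω → ℝ) :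
    IsClosed {p : (Ω → M → ℝ) × (M → A → ℝ) | SBR μ₀ uS p.1 p.2} := by
  have : {p : (Ω → M → ℝ) × (M → A → ℝ) | SBR μ₀ uS p.1 p.2}
      = ⋂ (σ' : Ω → M → ℝ), ⋂ (_ : IsMsg σ'),
        {p | U μ₀ uS σ' p.2 ≤ U μ₀ uS p.1 p.2} := by
    ext p; simp [SBR]
  rw [this]
  refine isClosed_iInter fun σ' => isClosed_iInter fun _ => isClosed_le ?_ (U_cont μ₀ uS)
  unfold U
  fun_prop

lemma isClosed_RBR (μ₀ : Ω → ℝ) (uR : A × Ω → ℝ) :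
    IsClosed {p : (Ω → M → ℝ) × (M → A → ℝ) | RBR μ₀ uR p.1 p.2} := by
  have : {p : (Ω → M → ℝ) × (M → A → ℝ) | RBR μ₀ uR p.1 p.2}
      = ⋂ (ρ' : M → A → ℝ), ⋂ (_ : IsAct ρ'),
        {p | U μ₀ uR p.1 ρ' ≤ U μ₀ uR p.1 p.2} := by
    ext p; simp [RBR]
  rw [this]
  refine isClosed_iInter fun ρ' => isClosed_iInter fun _ => isClosed_le ?_ (U_cont μ₀ uR)
  unfold U
  fun_prop

lemma isClosed_dists {I K Z : Type} [Fintype K] [TopologicalSpace Z] (g : Z → I → K → ℝ)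
    (hg : Continuous g) : IsClosed {z | ∀ i, IsDist (g z i)} := by
  have : {z | ∀ i, IsDist (g z i)} = ⋂ i, (fun z => g z i) ⁻¹' {f | IsDist f} := by
    ext z; simp
  rw [this]
  exact isClosed_iInter fun i => isClosed_dist.preimage (by fun_prop)

lemma dist_mem_Icc {X : Type} [Fintype X] (f : X → ℝ) (hf : IsDist f) (x : X) :
    f x ∈ Set.Icc (0 : ℝ) 1 :=
  ⟨hf.1 x, hf.2 ▸ Finset.single_le_sum (fun y _ => hf.1 y) (Finset.mem_univ x)⟩

lemma ct_attained [Nonempty Ω] [Nonempty A] [Nonempty M] (μ₀ : Ω → ℝ) (uS uR : A × Ω → ℝ) :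
    ∃ (σ : Ω → M → ℝ) (ρ : M → A → ℝ), CTEq μ₀ uS uR σ ρ ∧
      U μ₀ uS σ ρ = ctPayoff (M := M) μ₀ uS uR := by
  classical
  let K : Set ((Ω → M → ℝ) × (M → A → ℝ)) := {p | CTEq μ₀ uS uR p.1 p.2}
  have hKc : IsClosed K := by
    have c1 : IsClosed {p : (Ω → M → ℝ) × (M → A → ℝ) | IsMsg p.1} :=
      isClosed_dists (fun p : (Ω → M → ℝ) × (M → A → ℝ) => p.1) continuous_fst
    have c2 : IsClosed {p : (Ω → M → ℝ) × (M → A → ℝ) | IsAct p.2} :=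
      isClosed_dists (fun p : (Ω → M → ℝ) × (M → A → ℝ) => p.2) continuous_snd
    have c3 := isClosed_SBR (M := M) μ₀ uS
    have c4 := isClosed_RBR (M := M) μ₀ uR
    exact c1.inter (c2.inter (c3.inter c4))
  have hK : IsCompact K := by
    refine IsCompact.of_isClosed_subset
      ((isCompact_univ_pi fun _ : Ω => isCompact_univ_pi fun _ : M =>
          isCompact_Icc (a := (0 : ℝ)) (b := 1)).prod
        (isCompact_univ_pi fun _ : M => isCompact_univ_pi fun _ : A =>
          isCompact_Icc (a := (0 : ℝ)) (b := 1))) hKc ?_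
    rintro ⟨σ, ρ⟩ h
    exact ⟨fun ω _ m _ => dist_mem_Icc _ (h.1 ω) m, fun m _ a _ => dist_mem_Icc _ (h.2.1 m) a⟩
  have hne : K.Nonempty := by
    obtain ⟨a0, ha0⟩ := Finite.exists_max fun a => ∑ ω, μ₀ ω * uR (a, ω)
    obtain ⟨m0⟩ := (inferInstance : Nonempty M)
    have hσ : IsMsg (fun (_ : Ω) (m : M) => if m = m0 then (1 : ℝ) else 0) := fun ω =>
      ⟨fun m => by dsimp only; split_ifs <;> norm_num, by simp⟩
    have hρ : IsAct (fun (_ : M) (a : A) => if a = a0 then (1 : ℝ) else 0) := fun m =>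
      ⟨fun m => by dsimp only; split_ifs <;> norm_num, by simp⟩
    refine ⟨(fun _ m => if m = m0 then 1 else 0, fun _ a => if a = a0 then 1 else 0),
      hσ, hρ, ?_, ?_⟩
    · have : ∀ σ' : Ω → M → ℝ, IsMsg σ' →
          U μ₀ uS σ' (fun _ a => if a = a0 then 1 else 0) = ∑ ω, μ₀ ω * uS (a0, ω) := by
        intro σ' hσ'
        rw [U_eq_msg]
        simp [← Finset.sum_mul, (hσ' _).2]
      intro σ' hσ'
      rw [this _ hσ', this _ hσ]
    · intro ρ' hρ'
      rw [U_eq_act, U_eq_act]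
      simp only [mul_ite, mul_one, mul_zero, ite_mul, zero_mul, one_mul, Finset.sum_ite_eq',
        Finset.mem_univ, if_true]
      rw [Finset.sum_eq_single m0 (by intro b _ hb; simp [hb]) (by simp)]
      rw [Finset.sum_eq_single m0 (by intro b _ hb; simp [hb]) (by simp)]
      simp only [if_true]
      calc ∑ b, ρ' m0 b * ∑ ω, μ₀ ω * uR (b, ω)
          ≤ ∑ b, ρ' m0 b * ∑ ω, μ₀ ω * uR (a0, ω) :=
            Finset.sum_le_sum fun b _ => mul_le_mul_of_nonneg_left (ha0 b) ((hρ' _).1 b)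
        _ = _ := by rw [← Finset.sum_mul, (hρ' _).2, one_mul]
  have himg : {x | ∃ (σ : Ω → M → ℝ) (ρ : M → A → ℝ), CTEq μ₀ uS uR σ ρ ∧ x = U μ₀ uS σ ρ}
      = (fun p : (Ω → M → ℝ) × (M → A → ℝ) => U μ₀ uS p.1 p.2) '' K := by
    ext x
    constructor
    · rintro ⟨σ, ρ, h, rfl⟩; exact ⟨(σ, ρ), h, rfl⟩
    · rintro ⟨⟨σ, ρ⟩, h, rfl⟩; exact ⟨σ, ρ, h, rfl⟩
  have := (hK.image (U_cont μ₀ uS)).sSup_mem (hne.image _)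
  obtain ⟨⟨σ, ρ⟩, h, he⟩ := this
  refine ⟨σ, ρ, h, ?_⟩
  rw [ctPayoff, himg]; exact he

/-- Lemma (Kamenica–Lin): in a jointly-inclusive environment satisfying
partitional-unique-response and scant-indifferences, if commitment has no value
then the environment is felicitous. -/
theorem jointly_inclusive_no_value_implies_felicitous
    (Ω A M : Type) [Fintype Ω] [Fintype A] [Fintype M]
    [Nonempty Ω] [Nonempty A]
    (hM : max (Fintype.card Ω) (Fintype.card A) < Fintype.card M)
    (μ₀ : Ω → ℝ) (hμ : IsPrior μ₀)
    (uS uR : A × Ω → ℝ)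
    (huS : ∀ p, uS p ∈ Set.Icc (0 : ℝ) 1) (huR : ∀ p, uR p ∈ Set.Icc (0 : ℝ) 1)
    (hJI : JointlyInclusive uS uR)
    (hPUR : PUR μ₀ uR)
    (hscant : ScantIndiff uS uR)
    (hnoval : ¬ (ctPayoff (M := M) μ₀ uS uR < persPayoff (M := M) μ₀ uS uR)) :
    Felicitous μ₀ uS uR := by
  classical
  have hMA : Fintype.card A ≤ Fintype.card M := (le_max_right _ _).trans hM.le
  have : Nonempty M := Fintype.card_pos_iff.1 (by omega)
  obtain ⟨σ, ρ, ⟨hσ, hρ, hS, hR⟩, hval⟩ := ct_attained (M := M) μ₀ uS uR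
  have hopt : persPayoff (M := M) μ₀ uS uR ≤ U μ₀ uS σ ρ := by rw [hval]; exact not_lt.1 hnoval
  -- pointwise best responses
  have hRp : ∀ m a b, 0 < ρ m a →
      ∑ ω, μ₀ ω * σ ω m * uR (b, ω) ≤ ∑ ω, μ₀ ω * σ ω m * uR (a, ω) := by
    intro m a b h
    exact pointwise_opt ρ (fun m a => ∑ ω, μ₀ ω * σ ω m * uR (a, ω)) hρ
      (fun ρ' h' => by rw [← U_eq_act, ← U_eq_act]; exact hR ρ' h') m a b h
  have hSp : ∀ ω m m', 0 < σ ω m → ∑ a, ρ m' a * uS (a, ω) ≤ ∑ a, ρ m a * uS (a, ω) := by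
    intro ω m m' h
    have := pointwise_opt σ (fun ω m => μ₀ ω * ∑ a, ρ m a * uS (a, ω)) hσ
      (fun σ' h' => by rw [← U_eq_msg, ← U_eq_msg]; exact hS σ' h') ω m m' h
    exact le_of_mul_le_mul_left this (hμ.1 ω)
  let y : A → Ω → ℝ := fun a ω => ∑ m, ρ m a * (μ₀ ω * σ ω m)
  have hterm : ∀ m a ω, 0 ≤ ρ m a * (μ₀ ω * σ ω m) := fun m a ω =>
    mul_nonneg ((hρ m).1 a) (mul_nonneg (hμ.1 ω).le ((hσ ω).1 m))
  have hysum : ∀ (u : A × Ω → ℝ) a b, ∑ ω, y a ω * u (b, ω)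
      = ∑ m, ρ m a * ∑ ω, μ₀ ω * σ ω m * u (b, ω) := by
    intro u a b
    simp only [y, Finset.sum_mul, Finset.mul_sum]
    rw [Finset.sum_comm]
    exact Finset.sum_congr rfl fun m _ => Finset.sum_congr rfl fun ω _ => by ring
  have hobm : ∀ m a b, ρ m a * ∑ ω, μ₀ ω * σ ω m * uR (b, ω)
      ≤ ρ m a * ∑ ω, μ₀ ω * σ ω m * uR (a, ω) := by
    intro m a b
    rcases ((hρ m).1 a).eq_or_lt with h | h
    · simp [← h]
    · exact mul_le_mul_of_nonneg_left (hRp m a b h) h.le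
  have hy : Feas μ₀ uR y := by
    refine ⟨fun a ω => Finset.sum_nonneg fun m _ => hterm m a ω, fun ω => ?_, fun a b => ?_⟩
    · simp only [y]
      rw [Finset.sum_comm]
      simp_rw [← Finset.sum_mul, (hρ _).2, one_mul, ← Finset.mul_sum, (hσ _).2, mul_one]
    · rw [hysum, hysum]
      exact Finset.sum_le_sum fun m _ => hobm m a b
  have hoptY : persPayoff (M := M) μ₀ uS uR ≤ ∑ a, ∑ ω, y a ω * uS (a, ω) := by
    refine hopt.trans_eq ?_
    simp_rw [hysum]
    rw [Finset.sum_comm, U_eq_act]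
  -- purity on path
  have hpure : ∀ m ω0, 0 < σ ω0 m → ∀ i j, 0 < ρ m i → 0 < ρ m j → i = j := by
    intro m ω0 hω0 i j hi hj
    by_contra hij
    let x : Ω → ℝ := fun ω => μ₀ ω * σ ω m
    have hx : x ≠ 0 := fun h => (mul_pos (hμ.1 ω0) hω0).ne' (congrFun h ω0)
    have hxV : ∀ a b, ∑ ω, x ω * (uR (a, ω) - uR (b, ω))
        = ∑ ω, μ₀ ω * σ ω m * uR (a, ω) - ∑ ω, μ₀ ω * σ ω m * uR (b, ω) := by
      intro a b; simp only [x, mul_sub, Finset.sum_sub_distrib]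
    have hViVj := le_antisymm (hRp m j i hj) (hRp m i j hi)
    obtain ⟨d0, hd1, hd2, hd3⟩ := scant_dir uS uR hscant i j (Ne.symm hij)
      (fun b => ∑ ω, x ω * (uR (b, ω) - uR (i, ω)) = 0) x hx (fun _ h => h)
    obtain ⟨d, hd1, hd2, hd3⟩ : ∃ d : Ω → ℝ, (∀ ω, x ω = 0 → d ω = 0) ∧
      (∀ b, ∑ ω, x ω * (uR (b, ω) - uR (i, ω)) = 0 →
        ∑ ω, d ω * (uR (b, ω) - uR (i, ω)) = 0) ∧
      0 < ∑ ω, d ω * (uS (j, ω) - uS (i, ω)) := by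
      rcases lt_or_gt_of_ne hd3 with h | h
      · refine ⟨fun ω => - d0 ω, fun ω hω => by simp [hd1 ω hω], fun b hb => ?_, ?_⟩
        · simp only [neg_mul, Finset.sum_neg_distrib, hd2 b hb, neg_zero]
        · simp only [neg_mul, Finset.sum_neg_distrib]; linarith
      · exact ⟨d0, hd1, hd2, h⟩
    have hpos : ∀ a, 0 < ρ m a → ∀ ω, 0 < y a ω ∨ d ω = 0 := by
      intro a ha ω
      rcases (mul_nonneg (hμ.1 ω).le ((hσ ω).1 m)).eq_or_lt with h | h
      · exact Or.inr (hd1 ω h.symm)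
      · left
        exact Finset.sum_pos' (fun m' _ => hterm m' a ω) ⟨m, Finset.mem_univ _, mul_pos ha h⟩
    have hst : ∀ a, 0 < ρ m a → ∀ b,
        ∑ ω, y a ω * uR (b, ω) < ∑ ω, y a ω * uR (a, ω) ∨
        ∑ ω, μ₀ ω * σ ω m * uR (b, ω) = ∑ ω, μ₀ ω * σ ω m * uR (a, ω) := by
      intro a ha b
      rcases (hRp m a b ha).eq_or_lt with h | h
      · exact Or.inr h
      · left
        rw [hysum, hysum]
        exact Finset.sum_lt_sum (fun m' _ => hobm m' a b)
          ⟨m, Finset.mem_univ _, mul_lt_mul_of_pos_left h ha⟩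
    have := perturb hMA μ₀ hμ uS uR huS y hy hoptY i j hij d
      (fun ω => (hpos i hi ω).imp_right fun h => by simp [h])
      (fun ω => (hpos j hj ω).imp_right fun h => by simp [h])
      (fun b => (hst i hi b).imp_right fun h => (hd2 b (by rw [hxV, h, sub_self])).ge)
      (fun b => (hst j hj b).imp_right fun h => by
        have e1 := hd2 b (by rw [hxV, h, ← hViVj, sub_self])
        have e2 := hd2 j (by rw [hxV, hViVj, sub_self])
        have : ∑ ω, d ω * (uR (j, ω) - uR (b, ω)) = ∑ ω, d ω * (uR (j, ω) - uR (i, ω))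
            - ∑ ω, d ω * (uR (b, ω) - uR (i, ω)) := by
          rw [← Finset.sum_sub_distrib]
          exact Finset.sum_congr rfl fun ω _ => by ring
        rw [this, e1, e2, sub_self])
    linarith
  -- each on-path message has a pure action
  have hpa : ∀ m ω0, 0 < σ ω0 m → ∃ a, ∀ b, ρ m b = if b = a then 1 else 0 := by
    intro m ω0 h
    obtain ⟨a, -, ha⟩ : ∃ a ∈ Finset.univ, 0 < ρ m a := by
      apply Finset.exists_lt_of_sum_lt
      simp [(hρ m).2]
    have h0 : ∀ b, b ≠ a → ρ m b = 0 := fun b hb => by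
      by_contra hne
      exact hb (hpure m ω0 h b a (lt_of_le_of_ne ((hρ m).1 b) (Ne.symm hne)) ha)
    have h1 : ρ m a = 1 := by
      rw [← (hρ m).2, Finset.sum_eq_single a (fun b _ hb => h0 b hb) (by simp)]
    refine ⟨a, fun b => ?_⟩
    split_ifs with hb
    · rw [hb, h1]
    · exact h0 b hb
  have hex : ∀ ω, ∃ m, 0 < σ ω m := by
    intro ω
    obtain ⟨m, -, hm⟩ : ∃ m ∈ Finset.univ, 0 < σ ω m := by
      apply Finset.exists_lt_of_sum_lt
      simp [(hσ ω).2]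
    exact ⟨m, hm⟩
  choose m0 hm0 using hex
  choose β hβ using fun ω => hpa (m0 ω) ω (hm0 ω)
  -- every message used in a state induces the same action
  have hsame : ∀ ω m, 0 < σ ω m → ∀ b, ρ m b = if b = β ω then 1 else 0 := by
    intro ω m hm
    obtain ⟨a, ha⟩ := hpa m ω hm
    have e := le_antisymm (hSp ω m (m0 ω) hm) (hSp ω (m0 ω) m (hm0 ω))
    simp only [ha, hβ, ite_mul, one_mul, zero_mul, Finset.sum_ite_eq', Finset.mem_univ,
      if_true] at e
    rw [scant_strict uS uR hscant _ _ ω e]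
    exact ha
  have hyβ : ∀ a ω, y a ω = if β ω = a then μ₀ ω else 0 := by
    intro a ω
    have : ∀ m, ρ m a * (μ₀ ω * σ ω m) = (if β ω = a then μ₀ ω else 0) * σ ω m := by
      intro m
      rcases ((hσ ω).1 m).eq_or_lt with h | h
      · simp [← h]
      · rw [hsame ω m h a]
        by_cases hb : a = β ω
        · simp [hb]
        · simp [hb, Ne.symm hb]
    simp only [y, this]
    rw [← Finset.mul_sum, (hσ ω).2, mul_one]
  have hysumβ : ∀ a b, ∑ ω, y a ω * uR (b, ω)
      = ∑ ω ∈ Finset.univ.filter (fun ω => β ω = a), μ₀ ω * uR (b, ω) := by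
    intro a b
    rw [Finset.sum_filter]
    refine Finset.sum_congr rfl fun ω _ => ?_
    rw [hyβ, ite_mul, zero_mul]
  -- strict obedience
  have hstrict : ∀ ω b, b ≠ β ω →
      ∑ ω', y (β ω) ω' * uR (b, ω') < ∑ ω', y (β ω) ω' * uR (β ω, ω') := by
    intro ω b hb
    refine lt_of_le_of_ne (hy.obed _ _) fun he => hb ?_
    obtain ⟨c, hc, hu⟩ := hPUR (Finset.univ.filter (fun ω' => β ω' = β ω)) ⟨ω, by simp⟩
    have k1 := hu (β ω) (fun b' => by rw [← hysumβ, ← hysumβ]; exact hy.obed _ _)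
    have k2 := hu b (fun b' => by rw [← hysumβ, ← hysumβ, he]; exact hy.obed _ _)
    rw [k1, k2]
  -- every action is induced
  have hall : ∀ a, ∃ ω, β ω = a := by
    intro a
    obtain ⟨ω, h1, h2⟩ := hJI a
    refine ⟨ω, ?_⟩
    by_contra hne
    have := perturb hMA μ₀ hμ uS uR huS y hy hoptY (β ω) a hne (Pi.single ω 1)
      (fun ω' => by
        by_cases h : ω' = ω
        · subst h; left; rw [hyβ]; simp [hμ.1]
        · right; simp [h])
      (fun ω' => Or.inr (by
        by_cases h : ω' = ω
        · subst h; simp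
        · simp [h]))
      (fun b => by
        by_cases h : b = β ω
        · right; simp [h]
        · left; exact hstrict ω b h)
      (fun b => Or.inr (by
        simp only [Pi.single_apply, ite_mul, one_mul, zero_mul, Finset.sum_ite_eq',
          Finset.mem_univ, if_true]
        by_cases h : b = a
        · simp [h]
        · linarith [h2 b h]))
    simp only [Pi.single_apply, ite_mul, one_mul, zero_mul, Finset.sum_ite_eq',
          Finset.mem_univ, if_true] at this
    linarith [h1 _ hne]
  have hbest : ∀ ω a, uS (a, ω) ≤ uS (β ω, ω) := by
    intro ω a
    obtain ⟨ω', rfl⟩ := hall a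
    have := hSp ω (m0 ω) (m0 ω') (hm0 ω)
    simpa [hβ] using this
  have hideal : ∀ a, idealStates uS a = Finset.univ.filter (fun ω => β ω = a) := by
    intro a
    ext ω
    simp only [idealStates, Finset.mem_filter, Finset.mem_univ, true_and]
    constructor
    · intro h
      exact scant_strict uS uR hscant _ _ ω (le_antisymm (h _) (hbest ω a))
    · rintro rfl b
      exact hbest ω b
  intro a a'
  rw [hideal]
  simp only [mul_sub, Finset.sum_sub_distrib]
  rw [← hysumβ, ← hysumβ]
  exact sub_nonneg.2 (hy.obed a a')

end KL
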